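/- For every r ∈ [1,∞) there exists a compactly supported Borel probability measure μ on ℝ^q such that D̄_r(μ) > D̲_r(μ), i.e. the quantization dimension of order r does not exist. -/

import Mathlib

open MeasureTheory Filter Metric
open scoped ENNReal NNReal

/-- The `n`-th quantization error of order `r` for a measure `P`:
`e_{n,r}(P) = inf { (∫ d(x,α)^r dP)^{1/r} : α ⊆ E, 1 ≤ card α ≤ n }`. -/
noncomputable def quantError {E : Type*} [MetricSpace E] [MeasurableSpace E]
    (P : Measure E) (r : ℝ) (n : ℕ) : ℝ :=
  sInf {e : ℝ | ∃ α : Finset E, 1 ≤ α.card ∧ α.card ≤ n ∧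
    e = (∫ x, infDist x (↑α : Set E) ^ r ∂P) ^ (1 / r)}

/-- The upper quantization dimension of order `r`. -/
noncomputable def upperQuantDim {E : Type*} [MetricSpace E] [MeasurableSpace E]
    (P : Measure E) (r : ℝ) : ℝ :=
  limsup (fun n : ℕ => Real.log n / (- Real.log (quantError P r n))) atTop

/-- The lower quantization dimension of order `r`. -/
noncomputable def lowerQuantDim {E : Type*} [MetricSpace E] [MeasurableSpace E]
    (P : Measure E) (r : ℝ) : ℝ :=
  liminf (fun n : ℕ => Real.log n / (- Real.log (quantError P r n))) atTop

/-- The `s`-dimensional upper quantization coefficient of order `r`. -/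
noncomputable def upperQuantCoeff {E : Type*} [MetricSpace E] [MeasurableSpace E]
    (P : Measure E) (r s : ℝ) : ℝ≥0∞ :=
  limsup (fun n : ℕ => ENNReal.ofReal ((n : ℝ) ^ (1 / s) * quantError P r n)) atTop

/-- The `s`-dimensional lower quantization coefficient of order `r`. -/
noncomputable def lowerQuantCoeff {E : Type*} [MetricSpace E] [MeasurableSpace E]
    (P : Measure E) (r s : ℝ) : ℝ≥0∞ :=
  liminf (fun n : ℕ => ENNReal.ofReal ((n : ℝ) ^ (1 / s) * quantError P r n)) atTop

namespace QD

noncomputable def pt (q : ℕ) (hq : 0 < q) (t : ℝ) : EuclideanSpace ℝ (Fin q) :=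
  EuclideanSpace.single ⟨0, hq⟩ t

lemma dist_pt (q : ℕ) (hq : 0 < q) (s t : ℝ) : dist (pt q hq s) (pt q hq t) = |s - t| := by
  unfold pt
  rw [PiLp.dist_single_same, Real.dist_eq]

lemma pt_cont (q : ℕ) (hq : 0 < q) : Continuous (pt q hq) := by
  refine (Isometry.of_dist_eq fun s t => ?_).continuous
  rw [dist_pt, Real.dist_eq]

noncomputable def grid (q : ℕ) (hq : 0 < q) (N : ℕ) : Finset (EuclideanSpace ℝ (Fin q)) :=
  open Classical in (Finset.range N).image (fun j : ℕ => pt q hq (j / N))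

lemma grid_card (q : ℕ) (hq : 0 < q) (N : ℕ) : (grid q hq N).card ≤ N := by
  unfold grid
  exact Finset.card_image_le.trans (by simp)

lemma grid_card_pos (q : ℕ) (hq : 0 < q) (N : ℕ) (hN : 0 < N) : 1 ≤ (grid q hq N).card := by
  unfold grid
  apply Finset.card_pos.2
  simpa using hN.ne'

lemma mem_grid (q : ℕ) (hq : 0 < q) (N j : ℕ) (hj : j < N) : pt q hq (j / N) ∈ grid q hq N := by
  unfold grid
  exact Finset.mem_image.2 ⟨j, by simpa using hj, rfl⟩

/-- points of a coarser grid belong to a finer one -/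
lemma grid_sub (q : ℕ) (hq : 0 < q) (N M : ℕ) (hM : 0 < M) (h : N ∣ M) :
    grid q hq N ⊆ grid q hq M := by
  obtain ⟨c, rfl⟩ := h
  intro x hx
  unfold grid at hx
  obtain ⟨j, hj, rfl⟩ := Finset.mem_image.1 hx
  have hj : j < N := by simpa using hj
  have hc : 0 < c := Nat.pos_of_mul_pos_left hM
  have := mem_grid q hq (N * c) (j * c) (Nat.mul_lt_mul_of_pos_right hj hc)
  convert this using 2
  have hN : 0 < N := by omega
  have : (N:ℝ) ≠ 0 := by positivity
  have : (c:ℝ) ≠ 0 := by positivity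
  push_cast
  field_simp

noncomputable def K (q : ℕ) (hq : 0 < q) : Set (EuclideanSpace ℝ (Fin q)) :=
  pt q hq '' Set.Icc 0 1

lemma K_compact (q : ℕ) (hq : 0 < q) : IsCompact (K q hq) :=
  isCompact_Icc.image (pt_cont q hq)

lemma grid_K (q : ℕ) (hq : 0 < q) (N : ℕ) : (↑(grid q hq N) : Set _) ⊆ K q hq := by
  intro x hx
  unfold grid at hx
  obtain ⟨j, hj, rfl⟩ := Finset.mem_image.1 (Finset.mem_coe.1 hx)
  have hj : j < N := by simpa using hj
  refine ⟨_, ⟨by positivity, ?_⟩, rfl⟩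
  apply div_le_one_of_le₀ _ (by positivity)
  exact_mod_cast hj.le

lemma infDist_grid (q : ℕ) (hq : 0 < q) (N : ℕ) (hN : 0 < N) (x) (hx : x ∈ K q hq) :
    infDist x (↑(grid q hq N) : Set _) ≤ 1 / N := by
  obtain ⟨t, ⟨h0, h1⟩, rfl⟩ := hx
  have hN' : (0:ℝ) < N := by positivity
  obtain ⟨j, hj, h⟩ : ∃ j < N, |t - (j:ℝ) / N| ≤ 1 / N := by
    rcases eq_or_lt_of_le h1 with rfl | h1
    · refine ⟨N - 1, by omega, ?_⟩
      rw [Nat.cast_sub hN]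
      have : (1:ℝ) - (N - (1:ℕ)) / N = 1 / N := by field_simp; push_cast; ring
      rw [this, abs_of_pos (by positivity)]
    · refine ⟨⌊t * N⌋₊, ?_, ?_⟩
      · rw [Nat.floor_lt (by positivity)]
        nlinarith
      · have a := Nat.floor_le (show 0 ≤ t * N by positivity)
        have b := Nat.lt_floor_add_one (t * N)
        have : t - (⌊t * N⌋₊ : ℝ) / N = (t * N - ⌊t * N⌋₊) / N := by field_simp
        rw [this, abs_of_nonneg (by apply div_nonneg <;> linarith)]
        gcongr
        linarith
  calc _ ≤ dist (pt q hq t) (pt q hq (j / N)) := infDist_le_dist_of_mem (mem_grid q hq N j hj)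
    _ ≤ _ := by rw [dist_pt]; exact h

/-- counting: at most `card α` grid points are near `α`. -/
lemma count (q : ℕ) (hq : 0 < q) (n : ℕ) (hn : 0 < n) (α : Finset (EuclideanSpace ℝ (Fin q)))
    (h1 : 1 ≤ α.card) (h2 : α.card ≤ n) :
    n ≤ ((Finset.range (2 * n)).filter (fun j : ℕ =>
      1 / (2 * (2 * n : ℝ)) ≤ infDist (pt q hq (j / (2 * n : ℕ))) (↑α : Set _))).card := by
  classical
  have hc := Finset.card_filter_add_card_filter_not (s := Finset.range (2 * n)) (fun j : ℕ =>
      1 / (2 * (2 * n : ℝ)) ≤ infDist (pt q hq (j / (2 * n : ℕ))) (↑α : Set _))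
  have hne : (↑α : Set (EuclideanSpace ℝ (Fin q))).Nonempty := by
    simpa using Finset.card_pos.1 h1
  have hn' : (0:ℝ) < n := by positivity
  have : ((Finset.range (2 * n)).filter (fun j : ℕ =>
      ¬ 1 / (2 * (2 * n : ℝ)) ≤ infDist (pt q hq (j / (2 * n : ℕ))) (↑α : Set _))).card ≤ α.card := by
    have key : ∀ j : ℕ, ¬ 1 / (2 * (2 * n : ℝ)) ≤ infDist (pt q hq (j / (2 * n : ℕ))) (↑α : Set _) →
        ∃ a ∈ α, dist (pt q hq (j / (2 * n : ℕ))) a < 1 / (2 * (2 * n : ℝ)) := by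
      intro j hj
      obtain ⟨a, ha, h⟩ := (infDist_lt_iff hne).1 (not_le.1 hj)
      exact ⟨a, ha, h⟩
    choose! f hf using key
    refine Finset.card_le_card_of_injOn f (fun j hj => (hf j (Finset.mem_filter.1 hj).2).1) ?_
    intro i hi j hj hij
    have hi := (hf i (Finset.mem_filter.1 hi).2).2
    have hj := (hf j (Finset.mem_filter.1 hj).2).2
    rw [← hij] at hj
    have := (dist_triangle_right (pt q hq (i / (2 * n : ℕ))) (pt q hq (j / (2 * n : ℕ))) (f i))
    rw [dist_pt] at this
    have h3 : |(i:ℝ) / (2 * n : ℕ) - j / (2 * n : ℕ)| < 1 / (2 * n) := by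
      have : 1 / (2 * (2 * n : ℝ)) + 1 / (2 * (2 * n : ℝ)) = 1 / (2 * n) := by field_simp; norm_num
      linarith
    push_cast at h3
    rw [← sub_div, abs_div, abs_of_pos (show (0:ℝ) < 2 * n by positivity),
      div_lt_div_iff_of_pos_right (by positivity)] at h3
    have h4 : |(i:ℤ) - j| < 1 := by exact_mod_cast h3
    rw [Int.abs_lt_one_iff] at h4
    omega
  simp only [Finset.card_range] at hc
  omega

/-- uniform measure on grid -/
noncomputable def nu (q : ℕ) (hq : 0 < q) (N : ℕ) : Measure (EuclideanSpace ℝ (Fin q)) :=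
  ENNReal.ofReal (1 / N) • ∑ j ∈ Finset.range N, Measure.dirac (pt q hq ((j:ℝ) / N))

lemma nu_compl (q : ℕ) (hq : 0 < q) (N : ℕ) (S : Set (EuclideanSpace ℝ (Fin q)))
    (hS : MeasurableSet S) (h : (↑(grid q hq N) : Set _) ⊆ S) : nu q hq N Sᶜ = 0 := by
  unfold nu
  simp only [Measure.smul_apply, Measure.finsetSum_apply, smul_eq_mul]
  rw [Finset.sum_eq_zero, mul_zero]
  intro j hj
  rw [Measure.dirac_apply' _ hS.compl]
  have := h (mem_grid q hq N j (by simpa using hj))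
  simpa using this

lemma nu_univ (q : ℕ) (hq : 0 < q) (N : ℕ) (hN : 0 < N) : nu q hq N Set.univ = 1 := by
  unfold nu
  simp only [Measure.smul_apply, Measure.finsetSum_apply, smul_eq_mul]
  have hN' : (0:ℝ) < N := by positivity
  simp [ENNReal.ofReal_inv_of_pos hN']
  exact ENNReal.inv_mul_cancel (by positivity) (by simp)

noncomputable def w (r : ℝ) (k : ℕ) : ℝ := (2:ℝ) ^ (-(r * ((6:ℝ) ^ k - 1) / 2))

lemma w_zero (r : ℝ) : w r 0 = 1 := by simp [w]
lemma w_pos (r : ℝ) (k) : 0 < w r k := by unfold w; positivity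
lemma w_half (r : ℝ) (hr : 1 ≤ r) (k) : w r (k + 1) ≤ w r k / 2 := by
  unfold w
  have : (2:ℝ) ^ (-(r * ((6:ℝ) ^ k - 1) / 2)) / 2 = (2:ℝ) ^ (-(r * ((6:ℝ) ^ k - 1) / 2) - 1) := by
    rw [Real.rpow_sub (by norm_num), Real.rpow_one]
  rw [this]
  apply Real.rpow_le_rpow_of_exponent_le (by norm_num)
  have : (1:ℝ) ≤ 6 ^ k := one_le_pow₀ (by norm_num)
  rw [pow_succ]
  nlinarith

lemma w_le (r : ℝ) (hr : 1 ≤ r) (k) : w r k ≤ (1/2) ^ k := by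
  induction k with
  | zero => simp [w_zero]
  | succ k ih => 
    have := w_half r hr k
    rw [pow_succ]; linarith

noncomputable def p (r : ℝ) (k : ℕ) : ℝ := w r k - w r (k + 1)

lemma p_ge (r : ℝ) (hr : 1 ≤ r) (k) : w r k / 2 ≤ p r k := by
  have := w_half r hr k
  unfold p; linarith

lemma p_nonneg (r : ℝ) (hr : 1 ≤ r) (k) : 0 ≤ p r k := by
  have := p_ge r hr k
  have := w_pos r k
  linarith

lemma p_sum (r : ℝ) (k) : ∑ j ∈ Finset.range k, p r j = 1 - w r k := by
  unfold p
  rw [Finset.sum_range_sub', w_zero]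

lemma p_hasSum (r : ℝ) (hr : 1 ≤ r) : HasSum (p r) 1 := by
  rw [hasSum_iff_tendsto_nat_of_nonneg (p_nonneg r hr)]
  simp_rw [p_sum]
  have : Tendsto (w r) atTop (nhds 0) :=
    squeeze_zero (fun k => (w_pos r k).le) (w_le r hr)
      (tendsto_pow_atTop_nhds_zero_of_lt_one (by norm_num) (by norm_num))
  simpa using this.const_sub 1

def NN (k : ℕ) : ℕ := 2 ^ (6 ^ k)

lemma NN_pos (k : ℕ) : 0 < NN k := by unfold NN; positivity

lemma NN_dvd (j k : ℕ) (h : j ≤ k) : NN j ∣ NN k :=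
  pow_dvd_pow _ (Nat.pow_le_pow_right (by norm_num) h)

attribute [irreducible] NN

noncomputable def mu (q : ℕ) (hq : 0 < q) (r : ℝ) : Measure (EuclideanSpace ℝ (Fin q)) :=
  Measure.sum (fun k => ENNReal.ofReal (p r k) • nu q hq (NN k))

lemma mu_univ (q : ℕ) (hq : 0 < q) (r : ℝ) (hr : 1 ≤ r) : mu q hq r Set.univ = 1 := by
  unfold mu
  rw [Measure.sum_apply _ MeasurableSet.univ]
  simp only [Measure.smul_apply, smul_eq_mul]
  have : ∀ k, nu q hq (NN k) Set.univ = 1 := fun k => nu_univ q hq _ (NN_pos _)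
  simp only [this, mul_one]
  rw [← ENNReal.ofReal_tsum_of_nonneg (p_nonneg r hr) (p_hasSum r hr).summable,
    (p_hasSum r hr).tsum_eq, ENNReal.ofReal_one]

lemma mu_K (q : ℕ) (hq : 0 < q) (r : ℝ) : mu q hq r (K q hq)ᶜ = 0 := by
  have hK := (K_compact q hq).measurableSet
  unfold mu
  rw [Measure.sum_apply _ hK.compl]
  simp [nu_compl q hq _ _ hK (grid_K q hq _)]

lemma tail_sum (r : ℝ) (hr : 1 ≤ r) (m : ℕ) (f : ℕ → ℝ≥0∞) (h0 : ∀ j < m, f j = 0)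
    (h1 : ∀ j, f j ≤ ENNReal.ofReal (p r j)) : ∑' j, f j ≤ ENNReal.ofReal (w r m) := by
  have hs : HasSum (fun j => p r (j + m)) (w r m) := by
    have := (hasSum_nat_add_iff' m).2 (p_hasSum r hr)
    rw [p_sum] at this
    simpa using this
  have e : ∑' j, f j = ∑' j, f (j + m) := by
    have h := Summable.sum_add_tsum_nat_add' (f := f) (k := m) ENNReal.summable
    rw [Finset.sum_eq_zero (fun j hj => h0 j (Finset.mem_range.1 hj)), zero_add] at h
    exact h.symm
  rw [e, ← hs.tsum_eq, ENNReal.ofReal_tsum_of_nonneg (fun j => p_nonneg r hr _) hs.summable]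
  exact ENNReal.tsum_le_tsum fun j => h1 _

lemma mu_tail (q : ℕ) (hq : 0 < q) (r : ℝ) (hr : 1 ≤ r) (k : ℕ) :
    (mu q hq r).real (↑(grid q hq (NN k)) : Set _)ᶜ ≤ w r (k + 1) := by
  have hm : MeasurableSet (↑(grid q hq (NN k)) : Set (EuclideanSpace ℝ (Fin q))) :=
    (grid q hq (NN k)).measurableSet
  unfold Measure.real
  apply ENNReal.toReal_le_of_le_ofReal (w_pos _ _).le
  unfold mu
  rw [Measure.sum_apply _ hm.compl]
  apply tail_sum r hr
  · intro j hj
    have hj : j ≤ k := by omega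
    rw [Measure.smul_apply, nu_compl q hq _ _ hm, smul_zero]
    apply Finset.coe_subset.2
    exact grid_sub _ _ _ _ (NN_pos _) (NN_dvd j k hj)
  · intro j
    rw [Measure.smul_apply, smul_eq_mul]
    calc _ ≤ ENNReal.ofReal (p r j) * 1 := by
          gcongr
          rw [← nu_univ q hq (NN j) (NN_pos _)]
          exact measure_mono (Set.subset_univ _)
      _ = _ := mul_one _

lemma integrable_inf (q : ℕ) (hq : 0 < q) (r : ℝ) (hr : 1 ≤ r) (S : Set (EuclideanSpace ℝ (Fin q))) :
    Integrable (fun x => infDist x S ^ r) (mu q hq r) := by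
  have : IsProbabilityMeasure (mu q hq r) := ⟨mu_univ q hq r hr⟩
  have hc : Continuous (fun x => infDist x S ^ r) :=
    (continuous_infDist_pt S).rpow_const (fun _ => Or.inr (by linarith))
  obtain ⟨C, hC⟩ := (K_compact q hq).exists_bound_of_continuousOn hc.continuousOn
  refine Integrable.of_bound hc.aestronglyMeasurable C ?_
  have : ∀ᵐ x ∂(mu q hq r), x ∈ K q hq := mu_K q hq r
  filter_upwards [this] with x hx using hC x hx

lemma qe_le (q : ℕ) (hq : 0 < q) (r : ℝ) (n : ℕ) (α : Finset (EuclideanSpace ℝ (Fin q)))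
    (h1 : 1 ≤ α.card) (h2 : α.card ≤ n) (P : Measure (EuclideanSpace ℝ (Fin q))) :
    quantError P r n ≤ (∫ x, infDist x (↑α : Set _) ^ r ∂P) ^ (1 / r) := by
  refine csInf_le ⟨0, ?_⟩ ⟨α, h1, h2, rfl⟩
  rintro _ ⟨β, -, -, rfl⟩
  have : 0 ≤ ∫ x, infDist x (↑β : Set _) ^ r ∂P :=
    integral_nonneg fun x => Real.rpow_nonneg infDist_nonneg _
  positivity

lemma qe_nonneg (q : ℕ) (r : ℝ) (n : ℕ) (P : Measure (EuclideanSpace ℝ (Fin q))) :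
    0 ≤ quantError P r n := by
  refine Real.sInf_nonneg ?_
  rintro _ ⟨β, -, -, rfl⟩
  have : 0 ≤ ∫ x, infDist x (↑β : Set _) ^ r ∂P :=
    integral_nonneg fun x => Real.rpow_nonneg infDist_nonneg _
  positivity

lemma rpow_cancel (r x : ℝ) (hr : 1 ≤ r) (hx : 0 ≤ x) : (x ^ r) ^ (1 / r) = x := by
  rw [one_div, Real.rpow_rpow_inv hx (by linarith)]

lemma qe_upper (q : ℕ) (hq : 0 < q) (r : ℝ) (hr : 1 ≤ r) (n : ℕ) (hn : 0 < n) :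
    quantError (mu q hq r) r n ≤ 1 / n := by
  have : IsProbabilityMeasure (mu q hq r) := ⟨mu_univ q hq r hr⟩
  refine (qe_le q hq r n (grid q hq n) (grid_card_pos q hq n hn) (grid_card q hq n) _).trans ?_
  rw [← rpow_cancel r (1 / n) hr (by positivity)]
  apply Real.rpow_le_rpow (integral_nonneg fun x => Real.rpow_nonneg infDist_nonneg _) _
    (by positivity)
  calc _ ≤ ∫ x, (1 / n : ℝ) ^ r ∂(mu q hq r) := by
        refine integral_mono_ae (integrable_inf q hq r hr _) (integrable_const _) ?_
        have : ∀ᵐ x ∂(mu q hq r), x ∈ K q hq := mu_K q hq r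
        filter_upwards [this] with x hx
        exact Real.rpow_le_rpow infDist_nonneg (infDist_grid q hq n hn x hx) (by linarith)
    _ = _ := by simp

lemma qe_upper2 (q : ℕ) (hq : 0 < q) (r : ℝ) (hr : 1 ≤ r) (k : ℕ) :
    quantError (mu q hq r) r (NN k) ≤ w r (k + 1) ^ (1 / r) := by
  have : IsProbabilityMeasure (mu q hq r) := ⟨mu_univ q hq r hr⟩
  have hn : 0 < NN k := NN_pos k
  refine (qe_le q hq r _ (grid q hq _) (grid_card_pos q hq _ hn) (grid_card q hq _) _).trans ?_
  apply Real.rpow_le_rpow (integral_nonneg fun x => Real.rpow_nonneg infDist_nonneg _) _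
    (by positivity)
  have hm : MeasurableSet (↑(grid q hq (NN k)) : Set (EuclideanSpace ℝ (Fin q))) :=
    (grid q hq (NN k)).measurableSet
  refine le_trans ?_ (mu_tail q hq r hr k)
  rw [← integral_indicator_one hm.compl]
  refine integral_mono_ae (integrable_inf q hq r hr _)
    ((integrable_const (1:ℝ)).indicator hm.compl) ?_
  have : ∀ᵐ x ∂(mu q hq r), x ∈ K q hq := mu_K q hq r
  filter_upwards [this] with x hx
  by_cases h : x ∈ (↑(grid q hq (NN k)) : Set (EuclideanSpace ℝ (Fin q)))
  · simp only [infDist_zero_of_mem h]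
    rw [Real.zero_rpow (by linarith)]
    exact Set.indicator_nonneg (by simp) _
  · rw [Set.indicator_of_mem (show x ∈ (_ : Set _)ᶜ from h)]
    apply Real.rpow_le_one infDist_nonneg _ (by linarith)
    refine (infDist_grid q hq _ hn x hx).trans ?_
    apply div_le_one_of_le₀ _ (by positivity)
    exact_mod_cast hn

lemma qe_lower (q : ℕ) (hq : 0 < q) (r : ℝ) (hr : 1 ≤ r) (k n : ℕ) (hn : 0 < n)
    (hN : NN k = 2 * n) :
    (w r k / 4) ^ (1 / r) * (1 / (2 * (2 * n))) ≤ quantError (mu q hq r) r n := by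
  have hP : IsProbabilityMeasure (mu q hq r) := ⟨mu_univ q hq r hr⟩
  have hn' : (0:ℝ) < n := by positivity
  have hw := w_pos r k
  refine le_csInf ⟨_, grid q hq n, grid_card_pos q hq n hn, grid_card q hq n, rfl⟩ ?_
  rintro _ ⟨α, h1, h2, rfl⟩
  rw [← rpow_cancel r (1 / (2 * (2 * n))) hr (by positivity),
    ← Real.mul_rpow (by positivity) (by positivity)]
  apply Real.rpow_le_rpow (by positivity) _ (by positivity)
  have hle : ENNReal.ofReal (p r k) • nu q hq (NN k) ≤ mu q hq r := Measure.le_sum _ k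
  refine le_trans ?_ (integral_mono_measure hle
    (ae_of_all _ fun x => Real.rpow_nonneg infDist_nonneg _) (integrable_inf q hq r hr _))
  have hc : Continuous (fun x : EuclideanSpace ℝ (Fin q) => infDist x (↑α : Set _) ^ r) :=
    (continuous_infDist_pt _).rpow_const (fun _ => Or.inr (by linarith))
  unfold nu
  rw [integral_smul_measure, integral_smul_measure, integral_finsetSum_measure]
  · simp only [integral_dirac, ENNReal.toReal_ofReal (p_nonneg r hr k), smul_eq_mul]
    rw [ENNReal.toReal_ofReal (by positivity), hN]
    have hcount := count q hq n hn α h1 h2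
    have hsum : (n:ℝ) * (1 / (2 * (2 * n))) ^ r ≤
        ∑ j ∈ Finset.range (2 * n), infDist (pt q hq ((j:ℝ) / (2 * n : ℕ))) (↑α : Set _) ^ r := by
      calc (n:ℝ) * (1 / (2 * (2 * n))) ^ r ≤ _ * (1 / (2 * (2 * n))) ^ r :=
            mul_le_mul_of_nonneg_right (Nat.cast_le.2 hcount) (by positivity)
        _ ≤ ∑ j ∈ (Finset.range (2 * n)).filter (fun j : ℕ =>
              1 / (2 * (2 * n : ℝ)) ≤ infDist (pt q hq (j / (2 * n : ℕ))) (↑α : Set _)),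
              infDist (pt q hq ((j:ℝ) / (2 * n : ℕ))) (↑α : Set _) ^ r := by
            rw [← nsmul_eq_mul]
            apply Finset.card_nsmul_le_sum
            intro j hj
            exact Real.rpow_le_rpow (by positivity) (Finset.mem_filter.1 hj).2 (by linarith)
        _ ≤ _ := Finset.sum_le_sum_of_subset_of_nonneg (Finset.filter_subset _ _)
            fun _ _ _ => Real.rpow_nonneg infDist_nonneg _
    calc w r k / 4 * (1 / (2 * (2 * n))) ^ r
        = (w r k / 2) * (1 / (2 * n : ℕ) * (n * (1 / (2 * (2 * n))) ^ r)) := by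
          push_cast; field_simp; norm_num
      _ ≤ _ := by
          have := p_ge r hr k
          have : 0 ≤ p r k := p_nonneg r hr k
          gcongr
  · intro j hj
    exact integrable_dirac (by simp)

end QD

namespace QD

lemma w_root (r : ℝ) (hr : 1 ≤ r) (k : ℕ) :
    w r k ^ (1 / r) = (2:ℝ) ^ (-(((6:ℝ) ^ k - 1) / 2)) := by
  unfold w
  rw [← Real.rpow_mul (by norm_num)]
  congr 1
  field_simp

lemma u_nonneg (q : ℕ) (hq : 0 < q) (r : ℝ) (hr : 1 ≤ r) (n : ℕ) (hn : 0 < n) :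
    0 ≤ Real.log n / (- Real.log (quantError (mu q hq r) r n)) := by
  have h1 := qe_upper q hq r hr n hn
  have h0 := qe_nonneg q r n (mu q hq r)
  have hn1 : (1:ℝ) ≤ n := by exact_mod_cast hn
  apply div_nonneg (Real.log_nonneg hn1)
  have := Real.log_nonpos h0 (h1.trans (div_le_one_of_le₀ hn1 (by positivity)))
  linarith

lemma u_le (n c : ℝ) (e : ℝ) (hn : 1 ≤ n) (hc : 0 < c) (he : 0 ≤ e) (h : e ≤ n ^ (-c)) :
    Real.log n / (- Real.log e) ≤ 1 / c := by
  rcases eq_or_lt_of_le he with rfl | he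
  · simp; positivity
  have h2 := Real.log_le_log he h
  rw [Real.log_rpow (by linarith)] at h2
  have hl := Real.log_nonneg hn
  rcases eq_or_lt_of_le hl with hl | hl
  · rw [← hl]; simp; positivity
  have : 0 < - Real.log e := by nlinarith
  rw [div_le_div_iff₀ this hc]
  nlinarith

lemma le_u (n c : ℝ) (e : ℝ) (hn : 1 ≤ n) (hc : 0 < c) (he : e < 1) (hn0 : 0 < n) (h : n ^ (-c) ≤ e) :
    1 / c ≤ Real.log n / (- Real.log e) := by
  have hp : 0 < n ^ (-c) := by positivity
  have h2 := Real.log_le_log hp h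
  rw [Real.log_rpow (by linarith)] at h2
  have hl := Real.log_nonneg hn
  have : 0 < - Real.log e := by
    have := Real.log_neg (hp.trans_le h) he
    linarith
  rw [div_le_div_iff₀ hc this]
  nlinarith

lemma low (q : ℕ) (hq : 0 < q) (r : ℝ) (hr : 1 ≤ r) (k : ℕ) :
    Real.log (NN k : ℕ) / (- Real.log (quantError (mu q hq r) r (NN k))) ≤ 1 / (5 / 2) := by
  apply u_le _ _ _ _ (by norm_num) (qe_nonneg _ _ _ _)
  · refine (qe_upper2 q hq r hr k).trans ?_
    rw [w_root r hr]
    have : ((NN k : ℕ) : ℝ) = (2:ℝ) ^ ((6:ℝ) ^ k) := by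
      unfold NN
      push_cast
      rw [← Real.rpow_natCast]
      push_cast
      rfl
    rw [this, ← Real.rpow_mul (by norm_num)]
    apply Real.rpow_le_rpow_of_exponent_le (by norm_num)
    have : (1:ℝ) ≤ 6 ^ k := one_le_pow₀ (by norm_num)
    rw [pow_succ]
    linarith
  · unfold NN
    exact_mod_cast Nat.one_le_two_pow

lemma high (q : ℕ) (hq : 0 < q) (r : ℝ) (hr : 1 ≤ r) (k : ℕ) (hk : 2 ≤ k) :
    1 / 2 ≤ Real.log (2 ^ (6 ^ k - 1) : ℕ) /
      (- Real.log (quantError (mu q hq r) r (2 ^ (6 ^ k - 1)))) := by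
  have h36 : 36 ≤ 6 ^ k := le_trans (by norm_num) (Nat.pow_le_pow_right (show 0 < 6 by norm_num) hk)
  have h36' : (36:ℝ) ≤ 6 ^ k := by exact_mod_cast h36
  have hn : 1 < 2 ^ (6 ^ k - 1) := Nat.one_lt_two_pow (by omega)
  have hN : NN k = 2 * 2 ^ (6 ^ k - 1) := by
    unfold NN
    rw [← pow_succ']
    congr 1; omega
  have hl := qe_lower q hq r hr k _ (by positivity) hN
  have hup := qe_upper q hq r hr (2 ^ (6 ^ k - 1)) (by positivity)
  have hcast : ((2 ^ (6 ^ k - 1) : ℕ) : ℝ) = (2:ℝ) ^ ((6:ℝ) ^ k - 1) := by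
    push_cast
    rw [← Real.rpow_natCast, Nat.cast_sub (by omega)]
    push_cast
    rfl
  have hn1 : (1:ℝ) < (2 ^ (6 ^ k - 1) : ℕ) := by exact_mod_cast hn
  apply le_u _ _ _ hn1.le (by norm_num) _ (by linarith)
  · refine le_trans ?_ hl
    rw [hcast, Real.div_rpow (w_pos r k).le (by norm_num), w_root r hr]
    have h4 : (4:ℝ) ^ (1 / r) ≤ 4 := by
      conv_rhs => rw [← Real.rpow_one 4]
      apply Real.rpow_le_rpow_of_exponent_le (by norm_num)
      exact div_le_one_of_le₀ hr (by linarith)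
    have h4' : 0 < (4:ℝ) ^ (1 / r) := by positivity
    calc _ ≤ (2:ℝ) ^ (-(((6:ℝ) ^ k - 1) / 2) - 4 - ((6:ℝ) ^ k - 1)) := by
          rw [← Real.rpow_mul (by norm_num)]
          apply Real.rpow_le_rpow_of_exponent_le (by norm_num)
          linarith
      _ = (2:ℝ) ^ (-(((6:ℝ) ^ k - 1) / 2)) / 4 * (1 / (2 * (2 * (2:ℝ) ^ ((6:ℝ) ^ k - 1)))) := by
          rw [Real.rpow_sub (by norm_num), Real.rpow_sub (by norm_num)]
          have : (2:ℝ) ^ (4:ℝ) = 16 := by norm_num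
          rw [this]
          field_simp
          norm_num
      _ ≤ _ := by gcongr
  · refine hup.trans_lt ?_
    rw [div_lt_one (by linarith)]
    exact hn1

end QD

/-- for every `r ∈ [1,∞)` (and `q ≥ 1`) there exists a compactly supported
Borel probability measure `μ` on `ℝ^q` with `D̄_r(μ) > D̲_r(μ)`, i.e. the quantization
dimension of order `r` does not exist. -/
theorem exists_lowerQuantDim_lt_upperQuantDim (q : ℕ) (hq : 0 < q) (r : ℝ) (hr : 1 ≤ r) :
    ∃ μ : Measure (EuclideanSpace ℝ (Fin q)), IsProbabilityMeasure μ ∧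
      (∃ K : Set (EuclideanSpace ℝ (Fin q)), IsCompact K ∧ μ Kᶜ = 0) ∧
      lowerQuantDim μ r < upperQuantDim μ r := by
  refine ⟨QD.mu q hq r, ⟨QD.mu_univ q hq r hr⟩, ⟨QD.K q hq, QD.K_compact q hq, QD.mu_K q hq r⟩, ?_⟩
  have h0 : ∀ᶠ n : ℕ in atTop,
      0 ≤ Real.log n / (- Real.log (quantError (QD.mu q hq r) r n)) := by
    filter_upwards [eventually_gt_atTop 0] with n hn using QD.u_nonneg q hq r hr n hn
  have h1 : ∀ᶠ n : ℕ in atTop,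
      Real.log n / (- Real.log (quantError (QD.mu q hq r) r n)) ≤ 1 / 1 := by
    filter_upwards [eventually_gt_atTop 0] with n hn
    apply QD.u_le _ _ _ _ (by norm_num) (QD.qe_nonneg _ _ _ _)
    · rw [Real.rpow_neg_one, ← one_div]
      exact QD.qe_upper q hq r hr n hn
    · exact_mod_cast hn
  have hpow : ∀ a : ℕ, a < 6 ^ a := fun a => Nat.lt_pow_self (by norm_num)
  have hlow : lowerQuantDim (QD.mu q hq r) r ≤ 1 / (5 / 2) := by
    refine liminf_le_of_frequently_le ?_ ⟨0, h0⟩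
    rw [frequently_atTop]
    intro a
    refine ⟨QD.NN a, ?_, QD.low q hq r hr a⟩
    unfold QD.NN
    exact (hpow a).le.trans Nat.lt_two_pow_self.le
  have hhigh : 1 / 2 ≤ upperQuantDim (QD.mu q hq r) r := by
    refine le_limsup_of_frequently_le ?_ ⟨_, h1⟩
    rw [frequently_atTop]
    intro a
    refine ⟨2 ^ (6 ^ (a + 2) - 1), ?_, QD.high q hq r hr (a + 2) (by omega)⟩
    have := hpow (a + 2)
    exact le_trans (by omega) (Nat.lt_two_pow_self (n := 6 ^ (a + 2) - 1)).le
  refine hlow.trans_lt (lt_of_lt_of_le ?_ hhigh)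
  norm_num
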